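/- Let (A, m) be a Noetherian local ring whose associated graded ring G has depth exactly 1, witnessed by x ∈ m \ m^2 whose initial form x* ∈ G_1 is a nonzerodivisor on G. If m^ℓ does not have the strong Rees property, then m^{ℓ+1} does not have the strong Rees property. In particular, the set of ℓ for which m^ℓ has SRP is an initial segment {1, ..., n} (possibly all of ℕ). -/

import Mathlib

open IsLocalRing

/-- `mu I` is the minimal number of generators of the ideal `I`. -/
noncomputable def mu {A : Type*} [CommRing A] (I : Ideal A) : ℕ :=
  sInf {n | ∃ s : Finset A, s.card = n ∧ Ideal.span (s : Set A) = I}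

/-- An `m`-primary ideal has the strong Rees property if every strictly larger ideal
has strictly fewer generators. -/
def StrongReesProperty {A : Type*} [CommRing A] (I : Ideal A) : Prop :=
  ∀ J : Ideal A, I < J → mu J < mu I

section Helpers

variable {A : Type*} [CommRing A]

/-- Colength bookkeeping. -/
lemma colength_of_map {N : Type*} [AddCommGroup N] [Module A N] (K J : Ideal A) (hKJ : K ≤ J)
    (g : N →ₗ[A] A ⧸ K) (hg : LinearMap.range g = Submodule.map (Submodule.mkQ K) J)
    (L : Submodule A N) (hL : LinearMap.ker g = L) :
    Module.length A (A ⧸ K) = Module.length A (N ⧸ L) + Module.length A (A ⧸ J) := by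
  subst hL
  rw [Module.length_eq_add_of_exact (LinearMap.range g).subtype (LinearMap.range g).mkQ
    (Submodule.subtype_injective _) (Submodule.mkQ_surjective _)
    (LinearMap.exact_subtype_mkQ _), g.quotKerEquivRange.length_eq, hg,
    (Submodule.quotientQuotientEquivQuotient K J hKJ).length_eq]

lemma mu_eq_spanFinrank (I : Ideal A) : mu I = Submodule.spanFinrank I := by
  rw [Submodule.spanFinrank_eq_iInf, mu, iInf]
  congr 1
  ext n
  constructor
  · rintro ⟨s, h1, h2⟩
    exact ⟨⟨s, h2⟩, h1⟩
  · rintro ⟨⟨s, h2⟩, h1⟩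
    exact ⟨s, h1, h2⟩

variable [IsNoetherianRing A] [IsLocalRing A]

attribute [local instance] Ideal.Quotient.field in
lemma mu_eq_length (I : Ideal A) :
    (mu I : ℕ∞) = Module.length A (I ⧸ (maximalIdeal A) • (⊤ : Submodule A I)) := by
  have : Module.Finite (A ⧸ maximalIdeal A) (I ⧸ (maximalIdeal A) • (⊤ : Submodule A I)) :=
    Module.Finite.of_restrictScalars_finite A _ _
  rw [mu_eq_spanFinrank, spanFinrank_eq_finrank_quotient I (IsNoetherian.noetherian I),
    Module.length_eq_of_surjective (S := A) (R := A ⧸ maximalIdeal A) Ideal.Quotient.mk_surjective,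
    Module.length_eq_finrank]

lemma colength_mul (I : Ideal A) :
    Module.length A (A ⧸ (maximalIdeal A * I)) = mu I + Module.length A (A ⧸ I) := by
  rw [mu_eq_length]
  refine colength_of_map _ I Ideal.mul_le_right
    ((Submodule.mkQ (maximalIdeal A * I)).comp (Submodule.subtype I)) ?_ _ ?_
  · rw [LinearMap.range_comp, Submodule.range_subtype]
  · rw [LinearMap.ker_comp, Submodule.ker_mkQ]
    apply Submodule.map_injective_of_injective (Submodule.subtype_injective I)
    rw [Submodule.map_comap_subtype, Submodule.map_smul'', Submodule.map_subtype_top]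
    exact inf_eq_right.mpr Ideal.mul_le_right

lemma colength_pow (n : ℕ) : Module.length A (A ⧸ (maximalIdeal A ^ n)) ≠ ⊤ := by
  induction n with
  | zero =>
    rw [pow_zero, Ideal.one_eq_top, Module.length_eq_zero]
    simp
  | succ n ih =>
    rw [pow_succ', colength_mul]
    simpa using ih

lemma colength_anti {K J : Ideal A} (h : K ≤ J) :
    Module.length A (A ⧸ J) ≤ Module.length A (A ⧸ K) :=
  Module.length_le_of_surjective (Submodule.factor h) (Submodule.factor_surjective h)

lemma eq_of_colength {K J : Ideal A} (h : K ≤ J) (hf : Module.length A (A ⧸ K) ≠ ⊤)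
    (he : Module.length A (A ⧸ K) ≤ Module.length A (A ⧸ J)) : K = J := by
  have h1 := colength_of_map K J h ((Submodule.mkQ K).comp (Submodule.subtype J))
    (by rw [LinearMap.range_comp, Submodule.range_subtype]) (Submodule.comap J.subtype K)
    (by rw [LinearMap.ker_comp, Submodule.ker_mkQ])
  have h2 : Module.length A (J ⧸ Submodule.comap J.subtype K) = 0 := by
    have hJ : Module.length A (A ⧸ J) ≠ ⊤ := ne_top_of_le_ne_top hf (colength_anti h)
    rw [h1] at he
    generalize Module.length A (J ⧸ Submodule.comap J.subtype K) = a at *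
    generalize Module.length A (A ⧸ J) = b at *
    have ha : a ≠ ⊤ := by rintro rfl; simp_all
    lift a to ℕ using ha
    lift b to ℕ using hJ
    norm_cast at *
    omega
  rw [Module.length_eq_zero_iff, Submodule.Quotient.subsingleton_iff,
    Submodule.comap_subtype_eq_top] at h2
  exact le_antisymm h h2

lemma colength_mulx (x : A) (K I₀ J : Ideal A) (hK : K ≤ I₀) (hJ : I₀ ≤ J)
    (hcol : ∀ w, x * w ∈ K ↔ w ∈ I₀) (hf : Module.length A (A ⧸ K) ≠ ⊤) :
    Module.length A (A ⧸ (Ideal.span {x} * J ⊔ K)) + Module.length A (A ⧸ I₀) =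
      Module.length A (A ⧸ K) + Module.length A (A ⧸ J) := by
  have h1 := colength_of_map I₀ J hJ ((Submodule.mkQ I₀).comp (Submodule.subtype J))
    (by rw [LinearMap.range_comp, Submodule.range_subtype]) (Submodule.comap J.subtype I₀)
    (by rw [LinearMap.ker_comp, Submodule.ker_mkQ])
  have h2 := colength_of_map K (Ideal.span {x} * J ⊔ K) le_sup_right
    ((Submodule.mkQ K).comp ((LinearMap.mulLeft A x).comp (Submodule.subtype J)))
    (by
      rw [LinearMap.range_comp, LinearMap.range_comp, Submodule.range_subtype, Submodule.map_sup,
        Submodule.mkQ_map_self, sup_bot_eq]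
      congr 1
      ext y
      simp [Ideal.mem_span_singleton_mul])
    (Submodule.comap J.subtype I₀)
    (by
      ext y
      rw [LinearMap.mem_ker, Submodule.mem_comap]
      exact (Submodule.Quotient.mk_eq_zero K).trans (hcol _))
  rw [h1, h2]
  ring

/-- Watanabe's argument: for an `m`-full ideal and a bigger one. -/
lemma mfull_eq (x : A) (hx : x ∈ maximalIdeal A) (k : ℕ) (J : Ideal A)
    (hJ : maximalIdeal A ^ k ≤ J)
    (hcol : ∀ w, x * w ∈ maximalIdeal A ^ (k + 1) ↔ w ∈ maximalIdeal A ^ k) :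
    mu (maximalIdeal A ^ k) ≤ mu J ↔
      Ideal.span {x} * J ⊔ maximalIdeal A ^ (k + 1) = maximalIdeal A * J := by
  have h1 := colength_mulx x _ _ J (Ideal.pow_le_pow_right (Nat.le_succ k)) hJ hcol
    (colength_pow (k + 1))
  have h2 := colength_mul (maximalIdeal A ^ k)
  rw [← pow_succ'] at h2
  have h3 := colength_mul J
  have hle : Ideal.span {x} * J ⊔ maximalIdeal A ^ (k + 1) ≤ maximalIdeal A * J := by
    refine sup_le (Ideal.mul_mono_left ?_) ?_
    · rwa [Ideal.span_singleton_le_iff_mem]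
    · rw [pow_succ']
      exact Ideal.mul_mono_right hJ
  have hfJ : Module.length A (A ⧸ J) ≠ ⊤ := ne_top_of_le_ne_top (colength_pow k) (colength_anti hJ)
  have hfk := colength_pow (A := A) k
  have hfx : Module.length A (A ⧸ (Ideal.span {x} * J ⊔ maximalIdeal A ^ (k + 1))) ≠ ⊤ :=
    ne_top_of_le_ne_top (colength_pow (k + 1)) (colength_anti le_sup_right)
  have h4 : Module.length A (A ⧸ (Ideal.span {x} * J ⊔ maximalIdeal A ^ (k + 1))) =
      mu (maximalIdeal A ^ k) + Module.length A (A ⧸ J) := by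
    rw [h2] at h1
    have h1' : Module.length A (A ⧸ (Ideal.span {x} * J ⊔ maximalIdeal A ^ (k + 1))) +
      Module.length A (A ⧸ (maximalIdeal A ^ k)) =
      (mu (maximalIdeal A ^ k) + Module.length A (A ⧸ J)) +
        Module.length A (A ⧸ (maximalIdeal A ^ k)) := by
      rw [h1]; ring
    exact (WithTop.add_right_inj hfk).mp h1'
  constructor
  · intro h
    refine eq_of_colength hle hfx ?_
    rw [h4, h3]
    gcongr
  · intro h
    rw [h, h3] at h4
    have := (WithTop.add_right_inj hfJ).mp h4
    exact (Nat.cast_injective this).ge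

end Helpers

/-- Suppose the associated graded ring `G` has depth exactly one, witnessed by
`x ∈ m \ m²` whose initial form `x* ∈ G_1` is a nonzerodivisor on `G`.  If `m^ℓ` fails
the strong Rees property then so does `m^{ℓ+1}`. -/
theorem stmt11 {A : Type*} [CommRing A] [IsNoetherianRing A] [IsLocalRing A]
    (x : A) (hx : x ∈ maximalIdeal A) (hx2 : x ∉ maximalIdeal A ^ 2)
    (hreg : ∀ n : ℕ, ∀ w ∈ maximalIdeal A ^ n,
      x * w ∈ maximalIdeal A ^ (n + 2) → w ∈ maximalIdeal A ^ (n + 1))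
    (ℓ : ℕ) (hℓ : 1 ≤ ℓ)
    (h : ¬ StrongReesProperty (maximalIdeal A ^ ℓ)) :
    ¬ StrongReesProperty (maximalIdeal A ^ (ℓ + 1)) := by
  have hcol : ∀ k w, x * w ∈ maximalIdeal A ^ (k + 1) ↔ w ∈ maximalIdeal A ^ k := by
    intro k w
    constructor
    · intro hw
      have : ∀ j ≤ k, w ∈ maximalIdeal A ^ j := by
        intro j
        induction j with
        | zero => intro _; simp
        | succ j ih =>
          intro hj
          exact hreg j w (ih (by omega)) (Ideal.pow_le_pow_right (by omega) hw)
      exact this k le_rfl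
    · intro hw
      rw [pow_succ']
      exact Ideal.mul_mem_mul hx hw
  unfold StrongReesProperty at h
  push Not at h
  obtain ⟨I, hlt, hmu⟩ := h
  have hI := (mfull_eq x hx ℓ I hlt.le (hcol ℓ)).mp hmu
  have hle : maximalIdeal A ^ (ℓ + 1) ≤ maximalIdeal A * I := by
    rw [← hI]; exact le_sup_right
  intro hS
  refine absurd (hS (maximalIdeal A * I) (lt_of_le_of_ne hle ?_)) (not_lt.mpr ?_)
  · intro he
    refine absurd hlt (not_lt_of_ge ?_)
    intro w hw
    rw [← hcol, he]
    exact Ideal.mul_mem_mul hx hw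
  · rw [mfull_eq x hx (ℓ + 1) _ hle (hcol _)]
    conv_rhs => rw [← hI]
    rw [Ideal.mul_sup, ← pow_succ', mul_left_comm]
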